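/- For all dyadic rationals a and b with a < b, one has ch₀(ṽ(a)) > 0, ch₀(ṽ(b)) > 0 and ch₁(ṽ(a))/ch₀(ṽ(a)) < ch₁(ṽ(b))/ch₀(ṽ(b)); that is, the slope ch₁/ch₀ of the exceptional characters is a strictly increasing function of the dyadic number. -/

import Mathlib

/-- `vtil m p` is the exceptional character `ṽ(p / 2^m) ∈ ℝ³`, defined recursively:
`ṽ(n) = (1, n, n²/2)` for integers `n`; for odd `p` and `m > 0`,
if `p ≡ 3 (mod 4)` then `ṽ(p/2^m) = 3·ch₀(ṽ((p+1)/2^m))·ṽ((p−1)/2^m) − ṽ((p−3)/2^m)`,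
and if `p ≡ 1 (mod 4)` then `ṽ(p/2^m) = 3·ch₀(ṽ((p−1)/2^m))·ṽ((p+1)/2^m) − ṽ((p+3)/2^m)`.
For even `p` we reduce the fraction, so `vtil` is well defined on dyadic rationals
(each dyadic rational `q` is represented as `p / 2^m`). -/
noncomputable def vtil : ℕ → ℤ → ℝ × ℝ × ℝ
  | 0, p => (1, (p : ℝ), (p : ℝ) ^ 2 / 2)
  | m + 1, p =>
    if p % 2 = 0 then vtil m (p / 2)
    else if p % 4 = 3 then
      (3 * (vtil m ((p + 1) / 2)).1) • vtil m ((p - 1) / 2) - vtil m ((p - 3) / 2)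
    else
      (3 * (vtil m ((p - 1) / 2)).1) • vtil m ((p + 1) / 2) - vtil m ((p + 3) / 2)

theorem vtil_succ_two_mul (m : ℕ) (p : ℤ) : vtil (m + 1) (2 * p) = vtil m p := by
  rw [vtil, if_pos (by omega), show 2 * p / 2 = p by omega]

theorem vtil_succ_four_mul_add_one (m : ℕ) (q : ℤ) :
    vtil (m + 1) (4 * q + 1) =
      (3 * (vtil m (2 * q)).1) • vtil m (2 * q + 1) - vtil m (2 * q + 2) := by
  rw [vtil, if_neg (by omega), if_neg (by omega), show (4 * q + 1 - 1) / 2 = 2 * q by omega,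
    show (4 * q + 1 + 1) / 2 = 2 * q + 1 by omega, show (4 * q + 1 + 3) / 2 = 2 * q + 2 by omega]

theorem vtil_succ_four_mul_add_three (m : ℕ) (q : ℤ) :
    vtil (m + 1) (4 * q + 3) =
      (3 * (vtil m (2 * q + 2)).1) • vtil m (2 * q + 1) - vtil m (2 * q) := by
  rw [vtil, if_neg (by omega), if_pos (by omega), show (4 * q + 3 + 1) / 2 = 2 * q + 2 by omega,
    show (4 * q + 3 - 1) / 2 = 2 * q + 1 by omega, show (4 * q + 3 - 3) / 2 = 2 * q by omega]

theorem vtil_add_two_pow_mul (m k : ℕ) (p : ℤ) : vtil (m + k) (2 ^ k * p) = vtil m p := by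
  induction k with
  | zero => simp
  | succ k ih => rw [← ih, pow_succ', mul_assoc, ← add_assoc, vtil_succ_two_mul]

/-- The cross product `ch₀(v) ch₁(w) - ch₀(w) ch₁(v)`, positive exactly when the slope of `w`
exceeds that of `v` (for characters of positive rank). -/
def slopeDet (v w : ℝ × ℝ × ℝ) : ℝ := v.1 * w.2.1 - w.1 * v.2.1

/-- The relations satisfied by two neighbouring exceptional characters `a`, `b` and the
character `c` sitting between them on the next dyadic level. -/
structure IsMarkovTriple (a c b : ℝ × ℝ × ℝ) : Prop where
  one_le_left : 1 ≤ a.1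
  one_le_right : 1 ≤ b.1
  left_le : a.1 ≤ c.1
  right_le : b.1 ≤ c.1
  det_left : slopeDet a c = b.1
  det_right : slopeDet c b = a.1
  det_outer : slopeDet a b = 3 * a.1 * b.1 - c.1

theorem IsMarkovTriple.mutate_left {a c b : ℝ × ℝ × ℝ} (h : IsMarkovTriple a c b) :
    IsMarkovTriple a ((3 * a.1) • c - b) c := by
  obtain ⟨ha, hb, hac, hbc, h₁, h₂, h₃⟩ := h
  simp only [slopeDet] at h₁ h₂ h₃
  constructor <;>
    try simp only [slopeDet, Prod.fst_sub, Prod.snd_sub, Prod.smul_fst, Prod.smul_snd, smul_eq_mul]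
  · exact ha
  · linarith
  · nlinarith
  · nlinarith
  · linear_combination 3 * a.1 * h₁ - h₃
  · linear_combination h₂
  · linear_combination h₁

theorem IsMarkovTriple.mutate_right {a c b : ℝ × ℝ × ℝ} (h : IsMarkovTriple a c b) :
    IsMarkovTriple c ((3 * b.1) • c - a) b := by
  obtain ⟨ha, hb, hac, hbc, h₁, h₂, h₃⟩ := h
  simp only [slopeDet] at h₁ h₂ h₃
  constructor <;>
    try simp only [slopeDet, Prod.fst_sub, Prod.snd_sub, Prod.smul_fst, Prod.smul_snd, smul_eq_mul]
  · linarith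
  · exact hb
  · nlinarith
  · nlinarith
  · linear_combination h₁
  · linear_combination 3 * b.1 * h₂ - h₃
  · linear_combination h₂

theorem isMarkovTriple_vtil (m : ℕ) (p : ℤ) :
    IsMarkovTriple (vtil m p) (vtil (m + 1) (2 * p + 1)) (vtil m (p + 1)) := by
  induction m generalizing p with
  | zero =>
    obtain ⟨q, rfl | rfl⟩ := Int.even_or_odd' p
    · rw [show 2 * (2 * q) + 1 = 4 * q + 1 by ring, vtil_succ_four_mul_add_one]
      constructor <;> simp [vtil, slopeDet] <;> ring_nf <;> norm_num
    · rw [show 2 * (2 * q + 1) + 1 = 4 * q + 3 by ring, vtil_succ_four_mul_add_three]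
      constructor <;> simp [vtil, slopeDet] <;> ring_nf <;> norm_num
  | succ m ih =>
    obtain ⟨q, rfl | rfl⟩ := Int.even_or_odd' p
    · rw [show 2 * (2 * q) + 1 = 4 * q + 1 by ring, vtil_succ_four_mul_add_one,
        show 2 * q + 2 = 2 * (q + 1) by ring, vtil_succ_two_mul, vtil_succ_two_mul]
      exact (ih q).mutate_left
    · rw [show 2 * (2 * q + 1) + 1 = 4 * q + 3 by ring, vtil_succ_four_mul_add_three,
        show 2 * q + 1 + 1 = 2 * (q + 1) by ring, show 2 * q + 2 = 2 * (q + 1) by ring,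
        vtil_succ_two_mul, vtil_succ_two_mul]
      exact (ih q).mutate_right

theorem vtil_fst_pos (m : ℕ) (p : ℤ) : 0 < (vtil m p).1 :=
  one_pos.trans_le (isMarkovTriple_vtil m p).one_le_left

theorem slope_lt_of_slopeDet_pos {v w : ℝ × ℝ × ℝ} (hv : 0 < v.1) (hw : 0 < w.1)
    (h : 0 < slopeDet v w) : v.2.1 / v.1 < w.2.1 / w.1 := by
  rw [div_lt_div_iff₀ hv hw]
  unfold slopeDet at h
  linarith

theorem strictMono_slope_vtil (m : ℕ) :
    StrictMono fun p : ℤ => (vtil m p).2.1 / (vtil m p).1 := by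
  have left_lt (m : ℕ) (p : ℤ) := slope_lt_of_slopeDet_pos (vtil_fst_pos m p)
    (vtil_fst_pos (m + 1) (2 * p + 1))
    ((vtil_fst_pos m (p + 1)).trans_eq (isMarkovTriple_vtil m p).det_left.symm)
  have lt_right (m : ℕ) (p : ℤ) := slope_lt_of_slopeDet_pos (vtil_fst_pos (m + 1) (2 * p + 1))
    (vtil_fst_pos m (p + 1))
    ((vtil_fst_pos m p).trans_eq (isMarkovTriple_vtil m p).det_right.symm)
  exact strictMono_int_of_lt_succ fun p => (left_lt m p).trans (lt_right m p)

/-- The slope `ch₁/ch₀` of exceptional characters is a strictly increasing function of the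
dyadic number: for dyadic rationals `a = p₁/2^m₁ < b = p₂/2^m₂` one has
`ch₀(ṽ(a)) > 0`, `ch₀(ṽ(b)) > 0` and `ch₁(ṽ(a))/ch₀(ṽ(a)) < ch₁(ṽ(b))/ch₀(ṽ(b))`. -/
theorem exceptional_slope_strict_mono (m₁ : ℕ) (p₁ : ℤ) (m₂ : ℕ) (p₂ : ℤ)
    (h : (p₁ : ℝ) / 2 ^ m₁ < (p₂ : ℝ) / 2 ^ m₂) :
    0 < (vtil m₁ p₁).1 ∧ 0 < (vtil m₂ p₂).1 ∧
    (vtil m₁ p₁).2.1 / (vtil m₁ p₁).1 < (vtil m₂ p₂).2.1 / (vtil m₂ p₂).1 := by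
  refine ⟨vtil_fst_pos m₁ p₁, vtil_fst_pos m₂ p₂, ?_⟩
  have hlt : 2 ^ m₂ * p₁ < 2 ^ m₁ * p₂ := by
    rw [div_lt_div_iff₀ (by positivity) (by positivity)] at h
    have h' : p₁ * 2 ^ m₂ < p₂ * 2 ^ m₁ := by exact_mod_cast h
    linarith
  rw [← vtil_add_two_pow_mul m₁ m₂ p₁, ← vtil_add_two_pow_mul m₂ m₁ p₂, add_comm m₂ m₁]
  exact strictMono_slope_vtil (m₁ + m₂) hlt
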